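/- Let H be a real Hilbert space, D ⊆ H a symmetric set of unit vectors whose closed linear span is dense in H, and let f lie in the closed convex hull of D. Let (f_m)_{m≥0} be the Convex-Relaxed Greedy Algorithm iterates as above (greedy atom selection followed by exact line search over γ ∈ [0,1]). Then f_m converges to f in norm as m → ∞. -/

import Mathlib

open RealInnerProductSpace

/-- A linear functional bounded on a set satisfies the same bound on its closed convex hull. -/
lemma inner_le_of_mem_closure_convexHull {H : Type*} [NormedAddCommGroup H]
    [InnerProductSpace ℝ H] {D : Set H} {f r : H} {c : ℝ}
    (hf : f ∈ closure (convexHull ℝ D)) (h : ∀ x ∈ D, ⟪r, x⟫ ≤ c) : ⟪r, f⟫ ≤ c := by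
  have hclosed : IsClosed {x : H | ⟪r, x⟫ ≤ c} :=
    isClosed_le (by fun_prop) continuous_const
  have hconvex : Convex ℝ {x : H | ⟪r, x⟫ ≤ c} :=
    convex_halfSpace_le (innerₛₗ ℝ r).isLinear c
  exact closure_minimal (convexHull_min h hconvex) hclosed hf

lemma norm_le_of_mem_closure_convexHull {H : Type*} [NormedAddCommGroup H]
    [NormedSpace ℝ H] {D : Set H} {f : H} {c : ℝ}
    (hf : f ∈ closure (convexHull ℝ D)) (h : ∀ x ∈ D, ‖x‖ ≤ c) : ‖f‖ ≤ c := by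
  have hsub : D ⊆ Metric.closedBall (0 : H) c := fun x hx => by simpa using h x hx
  simpa using closure_minimal (convexHull_min hsub (convex_closedBall 0 c))
    Metric.isClosed_closedBall hf

/-- The relaxed step with parameter `t` towards an atom `x` that is at least as well aligned with
the residual `f - u` as `f` itself. -/
lemma norm_sq_relaxed_step_le {H : Type*} [NormedAddCommGroup H] [InnerProductSpace ℝ H]
    {f u x : H} {t : ℝ} (ht : t ∈ Set.Icc (0 : ℝ) 1) (hf : ‖f‖ ≤ 1) (hx : ‖x‖ ≤ 1)
    (h : ⟪f - u, f⟫ ≤ ⟪f - u, x⟫) :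
    ‖f - ((1 - t) • u + t • x)‖ ^ 2 ≤ (1 - t) ^ 2 * ‖f - u‖ ^ 2 + 4 * t ^ 2 := by
  have hdecomp : f - ((1 - t) • u + t • x) = (1 - t) • (f - u) + t • (f - x) := by module
  have hdist : ‖f - x‖ ^ 2 ≤ 4 := by
    have : ‖f - x‖ ≤ 2 := (norm_sub_le f x).trans (by linarith)
    nlinarith [norm_nonneg (f - x)]
  have hinner : ⟪f - u, f - x⟫ ≤ 0 := by rw [inner_sub_right]; linarith
  rw [hdecomp, norm_add_sq_real, real_inner_smul_left, real_inner_smul_right, norm_smul,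
    norm_smul, mul_pow, mul_pow, Real.norm_eq_abs, Real.norm_eq_abs, sq_abs, sq_abs]
  have h1 : (1 - t) * t * ⟪f - u, f - x⟫ ≤ 0 :=
    mul_nonpos_of_nonneg_of_nonpos (mul_nonneg (by linarith [ht.2]) ht.1) hinner
  nlinarith [mul_le_mul_of_nonneg_left hdist (sq_nonneg t)]

/-- The recursion obtained from the step sizes `1 / (m + 2)` forces decay of order `1 / m`. -/
lemma le_four_div_of_relaxed_recursion {a : ℕ → ℝ} (h0 : a 0 ≤ 4)
    (h : ∀ m, ∀ t ∈ Set.Icc (0 : ℝ) 1, a (m + 1) ≤ (1 - t) ^ 2 * a m + 4 * t ^ 2) (m : ℕ) :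
    a m ≤ 4 / ((m : ℝ) + 1) := by
  induction m with
  | zero => simpa using h0
  | succ m ih =>
    have ht : 1 / ((m : ℝ) + 2) ∈ Set.Icc (0 : ℝ) 1 :=
      ⟨by positivity, by rw [div_le_one (by positivity)]; linarith [m.cast_nonneg (α := ℝ)]⟩
    calc a (m + 1) ≤ (1 - 1 / ((m : ℝ) + 2)) ^ 2 * a m + 4 * (1 / ((m : ℝ) + 2)) ^ 2 := h m _ ht
      _ ≤ (1 - 1 / ((m : ℝ) + 2)) ^ 2 * (4 / ((m : ℝ) + 1)) + 4 * (1 / ((m : ℝ) + 2)) ^ 2 := by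
        gcongr
      _ = 4 / (((m + 1 : ℕ) : ℝ) + 1) := by
        push_cast
        have h1 : (m : ℝ) + 1 ≠ 0 := by positivity
        have h2 : (m : ℝ) + 2 ≠ 0 := by positivity
        have h3 : (m : ℝ) + 1 + 1 ≠ 0 := by positivity
        field_simp
        ring

/-- Convergence of the Convex-Relaxed Greedy Algorithm: with `D` a symmetric
dictionary (unit vectors with dense closed linear span) in a real Hilbert
space and `f` in the closed convex hull of `D`, the CRGA iterates `f_m`
converge to `f` in norm. -/
theorem stmt_11 {H : Type*} [NormedAddCommGroup H] [InnerProductSpace ℝ H]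
    [CompleteSpace H]
    (D : Set H) (hDunit : ∀ g ∈ D, ‖g‖ = 1) (hDsym : ∀ g ∈ D, -g ∈ D)
    (hDdense : Dense (↑(Submodule.span ℝ D) : Set H))
    (f : H) (hf : f ∈ closure (convexHull ℝ D))
    (F g : ℕ → H) (γ : ℕ → ℝ)
    (hF0 : F 0 = 0)
    (hg : ∀ m : ℕ, 1 ≤ m → g m ∈ D ∧
      ⟪f - F (m - 1), g m⟫ = sSup ((fun x => ⟪f - F (m - 1), x⟫) '' D))
    (hγ : ∀ m : ℕ, 1 ≤ m → γ m ∈ Set.Icc (0 : ℝ) 1 ∧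
      ∀ t ∈ Set.Icc (0 : ℝ) 1,
        ‖f - ((1 - γ m) • F (m - 1) + γ m • g m)‖ ^ 2 ≤
          ‖f - ((1 - t) • F (m - 1) + t • g m)‖ ^ 2)
    (hFm : ∀ m : ℕ, 1 ≤ m → F m = (1 - γ m) • F (m - 1) + γ m • g m) :
    Filter.Tendsto F Filter.atTop (nhds f) := by
  have hfnorm : ‖f‖ ≤ 1 := norm_le_of_mem_closure_convexHull hf fun x hx => (hDunit x hx).le
  have hrec : ∀ m, ∀ t ∈ Set.Icc (0 : ℝ) 1,
      ‖f - F (m + 1)‖ ^ 2 ≤ (1 - t) ^ 2 * ‖f - F m‖ ^ 2 + 4 * t ^ 2 := by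
    intro m t ht
    obtain ⟨hgD, hgmax⟩ := hg (m + 1) (by lia)
    have hstep := (hγ (m + 1) (by lia)).2 t ht
    rw [← hFm (m + 1) (by lia)] at hstep
    rw [Nat.add_sub_cancel] at hgmax hstep
    have hbdd : BddAbove ((fun x => ⟪f - F m, x⟫) '' D) := by
      refine ⟨‖f - F m‖, ?_⟩
      rintro _ ⟨x, hx, rfl⟩
      simpa [hDunit x hx] using real_inner_le_norm (f - F m) x
    have hinner : ⟪f - F m, f⟫ ≤ ⟪f - F m, g (m + 1)⟫ :=
      inner_le_of_mem_closure_convexHull hf fun x hx =>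
        hgmax ▸ le_csSup hbdd (Set.mem_image_of_mem _ hx)
    exact hstep.trans (norm_sq_relaxed_step_le ht hfnorm (hDunit _ hgD).le hinner)
  have hbound := le_four_div_of_relaxed_recursion (a := fun m => ‖f - F m‖ ^ 2)
    (by simp only [hF0, sub_zero]; nlinarith [norm_nonneg f]) hrec
  have hlim : Filter.Tendsto (fun m : ℕ => 4 / ((m : ℝ) + 1)) Filter.atTop (nhds 0) := by
    simpa [div_eq_mul_inv] using
      (tendsto_one_div_add_atTop_nhds_zero_nat (𝕜 := ℝ)).const_mul 4
  have hsq := squeeze_zero (fun m => sq_nonneg ‖f - F m‖) hbound hlim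
  rw [tendsto_iff_norm_sub_tendsto_zero]
  simpa [Real.sqrt_sq, norm_sub_rev] using hsq.sqrt
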